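/- Let G be an F6-free graph with m edges and no isolated vertices, where m ≥ 88. Then λ(G) = (1+√(4m−3))/2 holds if and only if m is odd and G is isomorphic to K_2 ∨ ((m−1)/2)K_1. -/

import Mathlib

open SimpleGraph Finset
open scoped Classical

/-- The spectral radius of a finite simple graph: the largest eigenvalue of its
adjacency matrix (expressed as the supremum of the set of eigenvalues). -/
noncomputable def specRad {V : Type*} [Fintype V] (G : SimpleGraph V) : ℝ :=
  sSup {t : ℝ | Module.End.HasEigenvalue (Matrix.toLin' (G.adjMatrix ℝ)) t}

/-- The fan graph `F₆ = K₁ ∨ P₅`: the path `0-1-2-3-4` together with the hub `5`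
adjacent to all of `0,…,4`. -/
def fan6 : SimpleGraph (Fin 6) :=
  SimpleGraph.fromRel (fun a b => b = 5 ∨ (b.val = a.val + 1 ∧ b.val ≤ 4))

/-- A graph is `F₆`-free if it contains no subgraph isomorphic to the fan `F₆`,
i.e. there is no injective graph homomorphism from `F₆` into it. -/
def F6Free {V : Type*} (G : SimpleGraph V) : Prop :=
  ¬ ∃ f : fan6 →g G, Function.Injective f

/-- The join `K₂ ∨ kK₁`: two adjacent vertices, each adjacent to `k` further
pairwise non-adjacent vertices. -/
def K2JoinEmpty (k : ℕ) : SimpleGraph (Fin 2 ⊕ Fin k) :=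
  SimpleGraph.fromRel (fun a b => a.isLeft ∨ b.isLeft)

/-- `dS G S v` is the number of neighbors of `v` lying in `S`. -/
noncomputable def dS {V : Type*} (G : SimpleGraph V) (S : Set V) (v : V) : ℕ :=
  (G.neighborSet v ∩ S).ncard

/-- `eIn G S` is the number of edges of the induced subgraph `G[S]`. -/
noncomputable def eIn {V : Type*} (G : SimpleGraph V) (S : Set V) : ℕ :=
  {e ∈ G.edgeSet | ∀ v ∈ e, v ∈ S}.ncard

/-- `eBetween G S T` is the number of edges with one endpoint in `S` and the
other in `T`. -/
noncomputable def eBetween {V : Type*} (G : SimpleGraph V) (S T : Set V) : ℕ :=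
  {e ∈ G.edgeSet | ∃ a ∈ S, ∃ b ∈ T, e = s(a, b)}.ncard

/-- `gamma G x ustar S = Σ_{u∈S} (d_S(u) - 1)·x_u/x_{u*} - e(S)`. -/
noncomputable def gamma {V : Type*} [Fintype V] (G : SimpleGraph V) (x : V → ℝ)
    (ustar : V) (S : Set V) : ℝ :=
  (∑ u ∈ S.toFinset, ((dS G S u : ℝ) - 1) * (x u / x ustar)) - eIn G S

/-- The star `K_{1,r}` with center `0` and `r` leaves. -/
def starGraph (r : ℕ) : SimpleGraph (Fin (r + 1)) :=
  SimpleGraph.fromRel (fun a _ => a = 0)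

/-- `K_{1,r} + e`: the star with center `0` and `r` leaves, plus an edge joining
the two leaves `1` and `2`. -/
def starPlusEdge (r : ℕ) : SimpleGraph (Fin (r + 1)) :=
  SimpleGraph.fromRel (fun a b => a = 0 ∨ (a = 1 ∧ b = 2))

/-- The double star `D_{a,b}`: centers `0` and `1` joined by an edge, `0` joined
to the `a` leaves `2,…,a+1`, and `1` joined to the `b` leaves `a+2,…,a+b+1`. -/
def doubleStar (a b : ℕ) : SimpleGraph (Fin (a + b + 2)) :=
  SimpleGraph.fromRel (fun u v =>
    (u.val = 0 ∧ v.val = 1) ∨ (u.val = 0 ∧ 2 ≤ v.val ∧ v.val < a + 2) ∨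
      (u.val = 1 ∧ a + 2 ≤ v.val))

/-- `K₄ - e`: the complete graph on 4 vertices minus the edge `{0,1}`. -/
def K4MinusE : SimpleGraph (Fin 4) :=
  SimpleGraph.fromRel (fun u v => ¬(u = 0 ∧ v = 1) ∧ ¬(u = 1 ∧ v = 0))

section FanConstraint

variable {V : Type*} {G : SimpleGraph V}

/-- In an `F₆`-free graph no neighbourhood contains a path on five vertices. -/
theorem F6Free.no_path (hfree : F6Free G) {h a b c d e : V}
    (ha : G.Adj h a) (hb : G.Adj h b) (hc : G.Adj h c) (hd : G.Adj h d) (he : G.Adj h e)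
    (hab : G.Adj a b) (hbc : G.Adj b c) (hcd : G.Adj c d) (hde : G.Adj d e)
    (hac : a ≠ c) (had : a ≠ d) (hae : a ≠ e) (hbd : b ≠ d) (hbe : b ≠ e) (hce : c ≠ e) :
    False := by
  apply hfree
  refine ⟨⟨![a, b, c, d, e, h], ?_⟩, ?_⟩
  · intro i j hij
    have := ha.symm; have := hb.symm; have := hc.symm; have := hd.symm; have := he.symm
    have := hab.symm; have := hbc.symm; have := hcd.symm; have := hde.symm
    fin_cases i <;> fin_cases j <;> simp_all [fan6]
  · have := ha.ne; have := hb.ne; have := hc.ne; have := hd.ne; have := he.ne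
    have := hab.ne; have := hbc.ne; have := hcd.ne; have := hde.ne
    intro i j hij
    fin_cases i <;> fin_cases j <;> simp_all

end FanConstraint

section Spectral

variable {V : Type*} [Fintype V]

theorem hasEigenvalue_adjMatrix_iff (G : SimpleGraph V) (t : ℝ) :
    Module.End.HasEigenvalue (Matrix.toLin' (G.adjMatrix ℝ)) t ↔
      ∃ y : V → ℝ, y ≠ 0 ∧ ∀ v, ∑ w with G.Adj v w, y w = t * y v := by
  have key : ∀ y : V → ℝ, (Matrix.toLin' (G.adjMatrix ℝ)) y = t • y ↔
      ∀ v, ∑ w with G.Adj v w, y w = t * y v := by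
    intro y
    rw [funext_iff]
    refine forall_congr' fun v => ?_
    rw [Matrix.toLin'_apply, adjMatrix_mulVec_apply, Pi.smul_apply, smul_eq_mul,
      neighborFinset_eq_filter]
  constructor
  · intro h
    obtain ⟨y, hy⟩ := h.exists_hasEigenvector
    exact ⟨y, hy.2, (key y).1 hy.apply_eq_smul⟩
  · rintro ⟨y, hy0, hy⟩
    exact Module.End.hasEigenvalue_of_hasEigenvector
      ⟨Module.End.mem_eigenspace_iff.2 ((key y).2 hy), hy0⟩

theorem isGreatest_specRad [Nonempty V] (G : SimpleGraph V) :
    IsGreatest {t : ℝ | Module.End.HasEigenvalue (Matrix.toLin' (G.adjMatrix ℝ)) t}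
      (specRad G) := by
  have hfin : {t : ℝ | Module.End.HasEigenvalue (Matrix.toLin' (G.adjMatrix ℝ)) t}.Finite :=
    Module.End.finite_hasEigenvalue _
  have hH : (G.adjMatrix ℝ).IsHermitian := by
    rw [Matrix.IsHermitian, Matrix.conjTranspose_eq_transpose_of_trivial, transpose_adjMatrix]
  have hne : {t : ℝ | Module.End.HasEigenvalue (Matrix.toLin' (G.adjMatrix ℝ)) t}.Nonempty := by
    obtain ⟨v⟩ := ‹Nonempty V›
    refine ⟨hH.eigenvalues v, ?_⟩
    refine Module.End.hasEigenvalue_of_hasEigenvector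
      (x := (hH.eigenvectorBasis v).ofLp) ⟨Module.End.mem_eigenspace_iff.2 ?_, ?_⟩
    · rw [Matrix.toLin'_apply]; exact hH.mulVec_eigenvectorBasis v
    · intro h0
      exact hH.eigenvectorBasis.orthonormal.ne_zero v (by ext i; exact congrFun h0 i)
  exact ⟨hne.csSup_mem hfin, fun t ht => le_csSup hfin.bddAbove ht⟩

/-- The largest eigenvalue has a nonnegative eigenvector with largest entry `1`. -/
theorem exists_perron_vector [Nonempty V] (G : SimpleGraph V) :
    ∃ (x : V → ℝ) (u : V), (∀ v, 0 ≤ x v) ∧ (∀ v, x v ≤ 1) ∧ x u = 1 ∧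
      ∀ v, ∑ w with G.Adj v w, x w = specRad G * x v := by
  obtain ⟨hmem, hub⟩ := isGreatest_specRad G
  set l := specRad G with hl
  set A := G.adjMatrix ℝ with hA
  have hH : A.IsHermitian := by
    rw [Matrix.IsHermitian, Matrix.conjTranspose_eq_transpose_of_trivial, transpose_adjMatrix]
  have hBH : (l • (1 : Matrix V V ℝ) - A).IsHermitian := by
    refine Matrix.IsHermitian.sub ?_ hH
    simp [Matrix.IsHermitian]
  have hpsd : (l • (1 : Matrix V V ℝ) - A).PosSemidef := by
    rw [hBH.posSemidef_iff_eigenvalues_nonneg]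
    intro v
    have h1 := hBH.mulVec_eigenvectorBasis v
    have : l - hBH.eigenvalues v ≤ l := by
      refine hub (Module.End.hasEigenvalue_of_hasEigenvector
        (x := (hBH.eigenvectorBasis v).ofLp) ⟨Module.End.mem_eigenspace_iff.2 ?_, ?_⟩)
      · rw [Matrix.toLin'_apply, sub_smul, ← h1, Matrix.sub_mulVec, Matrix.smul_mulVec,
          Matrix.one_mulVec]
        abel
      · intro h0
        exact hBH.eigenvectorBasis.orthonormal.ne_zero v (by ext i; exact congrFun h0 i)
    simpa using this
  obtain ⟨y, hy0, hy⟩ := (hasEigenvalue_adjMatrix_iff G l).1 hmem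
  have habs : ∀ v, ∑ w with G.Adj v w, |y w| = l * |y v| := by
    have hz : (l • (1 : Matrix V V ℝ) - A).mulVec (fun v => |y v|) = 0 := by
      have hform : star (fun v => |y v|) ⬝ᵥ (l • (1 : Matrix V V ℝ) - A).mulVec
          (fun v => |y v|) = ∑ v, |y v| * (l * |y v| - ∑ w with G.Adj v w, |y w|) := by
        simp only [dotProduct, Matrix.sub_mulVec, Matrix.smul_mulVec, Matrix.one_mulVec,
          Pi.sub_apply, Pi.smul_apply, smul_eq_mul, hA, adjMatrix_mulVec_apply,
          neighborFinset_eq_filter, Pi.star_apply, star_trivial]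
      rw [← hpsd.dotProduct_mulVec_zero_iff]
      refine le_antisymm ?_ (hpsd.dotProduct_mulVec_nonneg _)
      rw [hform]
      refine Finset.sum_nonpos fun v _ => ?_
      have h2 : |y v| * (l * |y v|) = y v * ∑ w with G.Adj v w, y w := by
        rw [hy v]; have := abs_mul_abs_self (y v); linear_combination l * this
      have h3 : y v * ∑ w with G.Adj v w, y w ≤ |y v| * ∑ w with G.Adj v w, |y w| := by
        refine (le_abs_self _).trans ?_
        rw [abs_mul]
        exact mul_le_mul_of_nonneg_left (Finset.abs_sum_le_sum_abs _ _) (abs_nonneg _)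
      rw [mul_sub]; linarith
    intro v
    have := congrFun hz v
    simp only [Matrix.sub_mulVec, Matrix.smul_mulVec, Matrix.one_mulVec,
      Pi.sub_apply, Pi.smul_apply, smul_eq_mul, hA, adjMatrix_mulVec_apply,
      neighborFinset_eq_filter, Pi.zero_apply] at this
    linarith
  obtain ⟨u, hu⟩ := Finite.exists_max (fun v => |y v|)
  have hpos : 0 < |y u| := by
    obtain ⟨v, hv⟩ := Function.ne_iff.1 hy0
    exact (abs_pos.2 hv).trans_le (hu v)
  refine ⟨fun v => |y v| / |y u|, u, fun v => by positivity,
    fun v => (div_le_one hpos).2 (hu v), div_self hpos.ne', fun v => ?_⟩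
  rw [← Finset.sum_div, habs v, mul_div_assoc]

theorem specRad_congr {U : Type*} [Fintype U] {G : SimpleGraph V} {H : SimpleGraph U}
    (f : G ≃g H) : specRad G = specRad H := by
  unfold specRad
  congr 1
  ext t
  rw [Set.mem_ofPred_eq, Set.mem_ofPred_eq, hasEigenvalue_adjMatrix_iff,
    hasEigenvalue_adjMatrix_iff]
  constructor
  · rintro ⟨y, hy0, hy⟩
    refine ⟨y ∘ f.symm, fun h => hy0 ?_, fun v => ?_⟩
    · ext v; simpa using congrFun h (f v)
    · rw [Function.comp_apply, ← hy, Finset.sum_filter, Finset.sum_filter,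
        ← f.toEquiv.sum_comp]
      refine Finset.sum_congr rfl fun w _ => ?_
      have : H.Adj v (f w) ↔ G.Adj (f.symm v) w := by
        rw [← f.map_adj_iff, f.apply_symm_apply]
      simp [this]
  · rintro ⟨y, hy0, hy⟩
    refine ⟨y ∘ f, fun h => hy0 ?_, fun v => ?_⟩
    · ext v; simpa using congrFun h (f.symm v)
    · rw [Function.comp_apply, ← hy, Finset.sum_filter, Finset.sum_filter,
        ← f.toEquiv.sum_comp]
      refine Finset.sum_congr rfl fun w _ => ?_
      simp [f.map_adj_iff]

theorem specRad_K2JoinEmpty {k : ℕ} (hk : 0 < k) :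
    specRad (K2JoinEmpty k) = (1 + Real.sqrt (8 * (k : ℝ) + 1)) / 2 := by
  have hk' : (0 : ℝ) < k := by exact_mod_cast hk
  set s := Real.sqrt (8 * (k : ℝ) + 1) with hs
  have hs2 : s ^ 2 = 8 * k + 1 := Real.sq_sqrt (by positivity)
  have hs0 : 0 ≤ s := Real.sqrt_nonneg _
  have hsum0 : ∀ y : Fin 2 ⊕ Fin k → ℝ, ∑ w with (K2JoinEmpty k).Adj (.inl 0) w, y w =
      y (.inl 1) + ∑ i, y (.inr i) := by
    intro y; rw [Finset.sum_filter]; simp [K2JoinEmpty]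
  have hsum1 : ∀ y : Fin 2 ⊕ Fin k → ℝ, ∑ w with (K2JoinEmpty k).Adj (.inl 1) w, y w =
      y (.inl 0) + ∑ i, y (.inr i) := by
    intro y; rw [Finset.sum_filter]; simp [K2JoinEmpty]
  have hsumr : ∀ (y : Fin 2 ⊕ Fin k → ℝ) (j : Fin k),
      ∑ w with (K2JoinEmpty k).Adj (.inr j) w, y w = y (.inl 0) + y (.inl 1) := by
    intro y j; rw [Finset.sum_filter]; simp [K2JoinEmpty]
  have : Nonempty (Fin 2 ⊕ Fin k) := ⟨.inl 0⟩
  refine (isGreatest_specRad _).unique ⟨?_, ?_⟩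
  · rw [Set.mem_ofPred_eq, hasEigenvalue_adjMatrix_iff]
    refine ⟨Sum.elim (fun _ => 1) (fun _ => 2 / ((1 + s) / 2)), fun h => ?_, ?_⟩
    · simpa using congrFun h (.inl 0)
    · have h1 : (k : ℝ) * (2 / ((1 + s) / 2)) = (1 + s) / 2 - 1 := by
        field_simp; nlinarith
      rintro (i | j)
      · fin_cases i
        · simp only [Fin.zero_eta, Fin.isValue, hsum0]; simp [h1]
        · simp only [Fin.mk_one, Fin.isValue, hsum1]; simp [h1]
      · rw [hsumr]; simp; field_simp; ring
  · intro t ht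
    rw [Set.mem_ofPred_eq, hasEigenvalue_adjMatrix_iff] at ht
    obtain ⟨y, hy0, hy⟩ := ht
    by_contra! hlt
    have ht0 : 0 < t := by linarith
    have e0 := hy (.inl 0); have e1 := hy (.inl 1)
    rw [hsum0] at e0; rw [hsum1] at e1
    have er : ∀ j, y (.inl 0) + y (.inl 1) = t * y (.inr j) := fun j => by rw [← hsumr, hy]
    have heq : y (.inl 0) = y (.inl 1) := by
      have : (t + 1) * (y (.inl 0) - y (.inl 1)) = 0 := by linarith
      rcases mul_eq_zero.1 this with h | h <;> linarith
    have hS : t * ∑ i, y (.inr i) = k * (y (.inl 0) + y (.inl 1)) := by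
      rw [Finset.mul_sum, ← Finset.sum_congr rfl fun j _ => er j]; simp; ring
    have hz : (t ^ 2 - t - 2 * k) * y (.inl 0) = 0 := by
      rw [heq] at e0 hS ⊢; linear_combination hS - t * e0
    have hq : t ^ 2 - t - 2 * k ≠ 0 := by nlinarith
    have h0 : y (.inl 0) = 0 := (mul_eq_zero.1 hz).resolve_left hq
    apply hy0
    ext (i | j)
    · fin_cases i
      · exact h0
      · exact heq ▸ h0
    · have := er j
      rw [← heq, h0, add_zero, eq_comm] at this
      exact (mul_eq_zero.1 this).resolve_left ht0.ne'

end Spectral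

section Counting

variable {V : Type*}

/-- The number of neighbours of `v` in `S`. -/
noncomputable def degIn (G : SimpleGraph V) (S : Finset V) (v : V) : ℕ :=
  #{w ∈ S | G.Adj v w}

/-- The total weight of the neighbours of `v` in `S`. -/
noncomputable def nbrSum (G : SimpleGraph V) (x : V → ℝ) (S : Finset V) (v : V) : ℝ :=
  ∑ w ∈ S with G.Adj v w, x w

variable {G : SimpleGraph V} {x : V → ℝ} {u v w : V} {S T : Finset V}

theorem nbrSum_one (S : Finset V) (v : V) : nbrSum G (fun _ => 1) S v = degIn G S v := by
  simp [nbrSum, degIn]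

theorem sum_nbrSum (G : SimpleGraph V) (x : V → ℝ) (S T : Finset V) :
    ∑ v ∈ S, nbrSum G x T v = ∑ w ∈ T, degIn G S w * x w := by
  simp only [nbrSum, Finset.sum_filter]
  rw [Finset.sum_comm]
  refine Finset.sum_congr rfl fun w _ => ?_
  rw [← Finset.sum_filter, Finset.sum_const, nsmul_eq_mul, degIn]
  simp only [G.adj_comm w]

theorem nbrSum_nonneg (hx : ∀ v, 0 ≤ x v) : 0 ≤ nbrSum G x S v :=
  Finset.sum_nonneg fun w _ => hx w

theorem nbrSum_le_degIn (hx : ∀ v, x v ≤ 1) : nbrSum G x S v ≤ degIn G S v := by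
  rw [← nbrSum_one]
  exact Finset.sum_le_sum fun w _ => hx w

theorem le_nbrSum (hx : ∀ v, 0 ≤ x v) (hw : w ∈ S) (h : G.Adj v w) : x w ≤ nbrSum G x S v :=
  Finset.single_le_sum (f := x) (fun w _ => hx w) (Finset.mem_filter.2 ⟨hw, h⟩)

theorem nbrSum_eq_sum (h : ∀ w, w ∈ T ↔ w ∈ S ∧ G.Adj v w) : nbrSum G x S v = ∑ w ∈ T, x w :=
  Finset.sum_congr (by ext w; simp [h]) fun _ _ => rfl

theorem degIn_eq_card (h : ∀ w, w ∈ T ↔ w ∈ S ∧ G.Adj v w) : degIn G S v = #T := by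
  rw [degIn]; congr 1; ext w; simp [h]

theorem degIn_pos (hw : w ∈ S) (h : G.Adj v w) : 0 < degIn G S v :=
  Finset.card_pos.2 ⟨w, Finset.mem_filter.2 ⟨hw, h⟩⟩

theorem one_lt_degIn {w' : V} (hw : w ∈ S) (h : G.Adj v w) (hw' : w' ∈ S) (h' : G.Adj v w')
    (hne : w ≠ w') : 1 < degIn G S v :=
  Finset.one_lt_card.2
    ⟨w, Finset.mem_filter.2 ⟨hw, h⟩, w', Finset.mem_filter.2 ⟨hw', h'⟩, hne⟩

theorem exists_adj_ne (h : 1 < degIn G S v) (p : V) : ∃ w ∈ S, G.Adj v w ∧ w ≠ p := by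
  obtain ⟨w, hw, hne⟩ := Finset.exists_mem_ne h p
  exact ⟨w, (Finset.mem_filter.1 hw).1, (Finset.mem_filter.1 hw).2, hne⟩

theorem exists_adj_of_degIn_pos (h : 0 < degIn G S v) : ∃ w ∈ S, G.Adj v w := by
  obtain ⟨w, hw⟩ := Finset.card_pos.1 h
  exact ⟨w, (Finset.mem_filter.1 hw).1, (Finset.mem_filter.1 hw).2⟩

theorem eq_of_degIn_eq_one {w' : V} (h1 : degIn G S v = 1) (hw : w ∈ S) (h : G.Adj v w)
    (hw' : w' ∈ S) (h' : G.Adj v w') : w = w' := by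
  by_contra hne
  have := one_lt_degIn hw h hw' h' hne
  omega

theorem nbrSum_le_add (hx : ∀ v, 0 ≤ x v) {a b : V} (hab : a ≠ b)
    (h : ∀ y ∈ S, G.Adj v y → y = a ∨ y = b) : nbrSum G x S v ≤ x a + x b := by
  rw [← Finset.sum_pair hab]
  refine Finset.sum_le_sum_of_subset_of_nonneg (fun y hy => ?_) fun y _ _ => hx y
  rw [mem_filter] at hy
  simpa using h y hy.1 hy.2

variable [Fintype V]

/-- The neighbours of `u`. -/
noncomputable def nbrs (G : SimpleGraph V) (u : V) : Finset V := {v | G.Adj u v}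

/-- The vertices at distance at least two from `u`. -/
noncomputable def far (G : SimpleGraph V) (u : V) : Finset V := {w | w ≠ u ∧ ¬ G.Adj u w}

theorem mem_nbrs : v ∈ nbrs G u ↔ G.Adj u v := by simp [nbrs]

theorem mem_far : w ∈ far G u ↔ w ≠ u ∧ ¬ G.Adj u w := by simp [far]

theorem nbrSum_univ (G : SimpleGraph V) (x : V → ℝ) (u v : V) :
    nbrSum G x univ v =
      (if G.Adj u v then x u else 0) + nbrSum G x (nbrs G u) v + nbrSum G x (far G u) v := by
  have h1 : (univ : Finset V) = ({u} ∪ nbrs G u) ∪ far G u := by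
    ext w; simp only [mem_univ, mem_union, mem_singleton, mem_nbrs, mem_far]; tauto
  have d1 : Disjoint ({u} ∪ nbrs G u) (far G u) := by
    rw [Finset.disjoint_left]; intro w
    simp only [mem_union, mem_singleton, mem_nbrs, mem_far]; tauto
  have d2 : Disjoint {u} (nbrs G u) := by
    rw [Finset.disjoint_left]; intro w
    simp only [mem_singleton, mem_nbrs]; rintro rfl; exact G.irrefl
  simp only [nbrSum, Finset.sum_filter]
  rw [h1, Finset.sum_union d1, Finset.sum_union d2, Finset.sum_singleton]
  simp only [G.adj_comm v u]

theorem sum_degIn_univ (G : SimpleGraph V) (u : V) :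
    (∑ v, degIn G univ v : ℝ) = 2 * #(nbrs G u) + ∑ v ∈ nbrs G u, (degIn G (nbrs G u) v : ℝ)
      + 2 * ∑ w ∈ far G u, (degIn G (nbrs G u) w : ℝ)
      + ∑ w ∈ far G u, (degIn G (far G u) w : ℝ) := by
  have h := fun S T => sum_nbrSum G (fun _ => (1 : ℝ)) S T
  simp only [nbrSum_one, mul_one] at h
  have e : ∀ S, (∑ v ∈ S, degIn G univ v : ℝ) = degIn G S u +
      ∑ w ∈ nbrs G u, (degIn G S w : ℝ) + ∑ w ∈ far G u, (degIn G S w : ℝ) := by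
    intro S
    have : ∀ v, (degIn G univ v : ℝ) = (if G.Adj v u then 1 else 0) + degIn G (nbrs G u) v
        + degIn G (far G u) v := by
      intro v
      rw [← nbrSum_one, nbrSum_univ G _ u v, nbrSum_one, nbrSum_one, G.adj_comm]
    simp only [this, Finset.sum_add_distrib, h]
    congr 2
    rw [← Finset.sum_filter, Finset.sum_const, nsmul_eq_mul, mul_one, degIn]
    simp only [G.adj_comm u]
  have hu : degIn G univ u = #(nbrs G u) := degIn_eq_card (by simp [mem_nbrs])
  rw [e univ, hu]
  have h0 : degIn G (far G u) u = 0 := by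
    rw [degIn_eq_card (T := ∅) (by simp [mem_far]), Finset.card_empty]
  have hN : degIn G (nbrs G u) u = #(nbrs G u) := degIn_eq_card (by simp [mem_nbrs])
  rw [e (nbrs G u), e (far G u), h0, hN, h (nbrs G u) (far G u)]
  push_cast
  ring

end Counting

section Discharging

variable {V : Type*}

/-- The number of neighbours of `v` in `S` that are not leaves of `G[S]`. -/
noncomputable def coreDeg (G : SimpleGraph V) (S : Finset V) (v : V) : ℕ :=
  #{w ∈ S | G.Adj v w ∧ degIn G S w ≠ 1}

/-- The contribution of `v` to `∑ v ∈ S, ((d(v) - 1) x(v) - d(v) / 2)` after every leaf of `G[S]`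
has passed its weight `-1 / 2` on to its neighbour. -/
noncomputable def charge (G : SimpleGraph V) (x : V → ℝ) (S : Finset V) (v : V) : ℝ :=
  ((degIn G S v : ℝ) - 1) * x v - degIn G S v / 2 +
    ∑ w ∈ S with G.Adj v w,
      ((if degIn G S v = 1 then (1 : ℝ) else 0) - (if degIn G S w = 1 then 1 else 0)) / 2

variable {G : SimpleGraph V} {x : V → ℝ} {u v w : V} {S : Finset V}

theorem sum_charge (G : SimpleGraph V) (x : V → ℝ) (S : Finset V) :
    ∑ v ∈ S, charge G x S v =
      ∑ v ∈ S, (((degIn G S v : ℝ) - 1) * x v - degIn G S v / 2) := by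
  set f : V → V → ℝ := fun v w => if G.Adj v w then
    ((if degIn G S v = 1 then (1 : ℝ) else 0) - (if degIn G S w = 1 then 1 else 0)) / 2 else 0
  have h0 : ∑ v ∈ S, ∑ w ∈ S, f v w = 0 := by
    have h1 : ∑ v ∈ S, ∑ w ∈ S, f v w = ∑ v ∈ S, ∑ w ∈ S, -f v w := by
      rw [Finset.sum_comm]
      refine Finset.sum_congr rfl fun v _ => Finset.sum_congr rfl fun w _ => ?_
      simp only [f, G.adj_comm w v]
      split_ifs <;> ring
    simp only [Finset.sum_neg_distrib] at h1
    linarith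
  simp only [charge, Finset.sum_add_distrib, Finset.sum_filter]
  simp only [f] at h0
  rw [h0, add_zero]

theorem charge_of_degIn_eq_zero (h : degIn G S v = 0) : charge G x S v = -x v := by
  have : {w ∈ S | G.Adj v w} = ∅ := Finset.card_eq_zero.1 h
  simp [charge, h, this]

theorem charge_of_degIn_eq_one (h : degIn G S v = 1) (hw : w ∈ S) (hvw : G.Adj v w) :
    charge G x S v = if degIn G S w = 1 then -(1 / 2) else 0 := by
  have : {w ∈ S | G.Adj v w} = {w} := by
    ext z
    simp only [mem_filter, mem_singleton]
    refine ⟨fun hz => eq_of_degIn_eq_one h hz.1 hz.2 hw hvw, ?_⟩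
    rintro rfl; exact ⟨hw, hvw⟩
  rw [charge, this, Finset.sum_singleton]
  simp only [h]
  split_ifs <;> norm_num

theorem charge_of_one_lt_degIn (h : 1 < degIn G S v) :
    charge G x S v = (coreDeg G S v : ℝ) / 2 - 1 - ((degIn G S v : ℝ) - 1) * (1 - x v) := by
  have h1 : degIn G S v ≠ 1 := h.ne'
  have h2 : ∑ w ∈ S with G.Adj v w, (if degIn G S w = 1 then (1 : ℝ) else 0) =
      degIn G S v - coreDeg G S v := by
    have e : ∀ w, (if degIn G S w = 1 then (1 : ℝ) else 0) =
        1 - (if degIn G S w ≠ 1 then (1 : ℝ) else 0) := by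
      intro w; split_ifs <;> simp_all
    simp only [e, Finset.sum_sub_distrib]
    rw [← Finset.sum_filter, Finset.filter_filter]
    simp [coreDeg, degIn]
  rw [charge, ← Finset.sum_div, Finset.sum_sub_distrib, h2]
  simp only [h1, if_false, Finset.sum_const_zero]
  ring

theorem charge_nonpos (hx : ∀ v, 0 ≤ x v) (hx1 : ∀ v, x v ≤ 1) (hk : coreDeg G S v ≤ 2) :
    charge G x S v ≤ 0 := by
  rcases Nat.lt_trichotomy (degIn G S v) 1 with h | h | h
  · rw [charge_of_degIn_eq_zero (by omega)]; linarith [hx v]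
  · obtain ⟨w, hw, hvw⟩ := exists_adj_of_degIn_pos (h ▸ Nat.one_pos)
    rw [charge_of_degIn_eq_one h hw hvw]; split_ifs <;> norm_num
  · rw [charge_of_one_lt_degIn h]
    have h2 : (coreDeg G S v : ℝ) ≤ 2 := by exact_mod_cast hk
    have h3 : (2 : ℝ) ≤ degIn G S v := by exact_mod_cast h
    nlinarith [hx1 v]

theorem charge_le_of_one_lt_degIn (hx1 : ∀ v, x v ≤ 1) (hk : coreDeg G S v ≤ 2)
    (h : 1 < degIn G S v) : charge G x S v ≤ -(1 - x v) := by
  rw [charge_of_one_lt_degIn h]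
  have h2 : (coreDeg G S v : ℝ) ≤ 2 := by exact_mod_cast hk
  have h3 : (2 : ℝ) ≤ degIn G S v := by exact_mod_cast h
  nlinarith [hx1 v]

theorem coreDeg_eq_degIn
    (h : ∀ w ∈ S, G.Adj v w → degIn G S w ≠ 1) : coreDeg G S v = degIn G S v := by
  rw [coreDeg, degIn]
  congr 1
  ext w
  simp only [mem_filter]
  exact ⟨fun hw => ⟨hw.1, hw.2.1⟩, fun hw => ⟨hw.1, hw.2, h w hw.1 hw.2⟩⟩

/-- Four distinct vertices of `S` inducing `K₄` or `K₄ - e`, with `a` and `b` of degree three. -/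
structure IsDiamond (G : SimpleGraph V) (S : Finset V) (a b c e : V) : Prop where
  ha : a ∈ S
  hb : b ∈ S
  hc : c ∈ S
  he : e ∈ S
  ab : G.Adj a b
  ac : G.Adj a c
  ae : G.Adj a e
  bc : G.Adj b c
  be : G.Adj b e
  ne : c ≠ e

theorem IsDiamond.swap {a b c e : V} (h : IsDiamond G S a b c e) : IsDiamond G S b a c e :=
  ⟨h.hb, h.ha, h.hc, h.he, h.ab.symm, h.bc, h.be, h.ac, h.ae, h.ne⟩

theorem IsDiamond.swap' {a b c e : V} (h : IsDiamond G S a b c e) : IsDiamond G S a b e c :=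
  ⟨h.ha, h.hb, h.he, h.hc, h.ab, h.ae, h.ac, h.be, h.bc, h.ne.symm⟩

theorem IsDiamond.card_eq_four {a b c e : V} (h : IsDiamond G S a b c e) :
    #({a, b, c, e} : Finset V) = 4 := by
  have := h.ab.ne; have := h.ac.ne; have := h.ae.ne; have := h.bc.ne; have := h.be.ne
  have := h.ne
  simp [*]

theorem IsDiamond.one_lt_degIn {a b c e : V} (h : IsDiamond G S a b c e) :
    ∀ v ∈ ({a, b, c, e} : Finset V), 1 < degIn G S v := by
  intro v hv
  simp only [mem_insert, mem_singleton] at hv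
  rcases hv with rfl | rfl | rfl | rfl
  · exact _root_.one_lt_degIn h.hb h.ab h.hc h.ac h.bc.ne
  · exact _root_.one_lt_degIn h.ha h.ab.symm h.hc h.bc h.ac.ne
  · exact _root_.one_lt_degIn h.ha h.ac.symm h.hb h.bc.symm h.ab.ne
  · exact _root_.one_lt_degIn h.ha h.ae.symm h.hb h.be.symm h.ab.ne

variable [Fintype V]

theorem F6Free.no_path_nbrs (hfree : F6Free G) {a b c d e : V}
    (ha : a ∈ nbrs G u) (hb : b ∈ nbrs G u) (hc : c ∈ nbrs G u) (hd : d ∈ nbrs G u)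
    (he : e ∈ nbrs G u)
    (hab : G.Adj a b) (hbc : G.Adj b c) (hcd : G.Adj c d) (hde : G.Adj d e)
    (hac : a ≠ c) (had : a ≠ d) (hae : a ≠ e) (hbd : b ≠ d) (hbe : b ≠ e) (hce : c ≠ e) :
    False := by
  rw [mem_nbrs] at *
  exact hfree.no_path ha hb hc hd he hab hbc hcd hde hac had hae hbd hbe hce

/-- Two vertices outside the neighbourhood of `u` cannot have in common a vertex `p` of it while
being joined to two different neighbours of `p` in it. -/
theorem F6Free.eq_of_adj (hfree : F6Free G) {p q r w₁ w₂ : V}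
    (hp : p ∈ nbrs G u) (hq : q ∈ nbrs G u) (hr : r ∈ nbrs G u) (hpq : G.Adj p q)
    (hpr : G.Adj p r) (hqr : q ≠ r) (h₁ : w₁ ∈ far G u) (h₂ : w₂ ∈ far G u)
    (hp₁ : G.Adj w₁ p) (hq₁ : G.Adj w₁ q) (hp₂ : G.Adj w₂ p) (hr₂ : G.Adj w₂ r) :
    w₁ = w₂ := by
  by_contra hne
  rw [mem_nbrs] at hp hq hr
  rw [mem_far] at h₁ h₂
  refine hfree.no_path hp₁.symm hpq hp.symm hpr hp₂.symm hq₁ hq.symm hr hr₂.symm h₁.1 ?_ hne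
    hqr ?_ h₂.1.symm
  · rintro rfl; exact h₁.2 hr
  · rintro rfl; exact h₂.2 hq

theorem IsDiamond.eq_of_adj_left (hfree : F6Free G) {a b c e y : V}
    (h : IsDiamond G (nbrs G u) a b c e) (hy : y ∈ nbrs G u) (hay : G.Adj a y) :
    y = b ∨ y = c ∨ y = e := by
  by_contra! hne
  exact hfree.no_path_nbrs hy h.ha h.hc h.hb h.he hay.symm h.ac h.bc.symm h.be
    hne.2.1 hne.1 hne.2.2 h.ab.ne h.ae.ne h.ne

theorem IsDiamond.eq_of_adj_right (hfree : F6Free G) {a b c e y : V}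
    (h : IsDiamond G (nbrs G u) a b c e) (hy : y ∈ nbrs G u) (hcy : G.Adj c y) :
    y = a ∨ y = b ∨ y = e := by
  by_contra! hne
  exact hfree.no_path_nbrs hy h.hc h.ha h.hb h.he hcy.symm h.ac.symm h.ab h.be
    hne.1 hne.2.1 hne.2.2 h.bc.ne.symm h.ne h.ae.ne

/-- A vertex with three non-leaf neighbours lies in a diamond. -/
theorem F6Free.exists_isDiamond (hfree : F6Free G) (hv : v ∈ nbrs G u)
    (hk : 2 < coreDeg G (nbrs G u) v) : ∃ b c e, IsDiamond G (nbrs G u) v b c e := by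
  have key : ∀ p q r p' q' r', p ∈ nbrs G u → q ∈ nbrs G u → r ∈ nbrs G u → p' ∈ nbrs G u →
      q' ∈ nbrs G u → r' ∈ nbrs G u → G.Adj v p → G.Adj v q → G.Adj v r → p ≠ q → p ≠ r →
      q ≠ r → G.Adj p p' → p' ≠ v → G.Adj q q' → q' ≠ v → G.Adj r r' → r' ≠ v →
      p' = q ∨ p' = r := by
    intro p q r p' q' r' hp hq hr hp' hq' hr' vp vq vr pq pr qr pp' p'v qq' q'v rr' r'v
    by_contra! hne
    have aux : ∀ q r q', q ∈ nbrs G u → r ∈ nbrs G u → q' ∈ nbrs G u → G.Adj v q → G.Adj v r →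
        p ≠ q → p ≠ r → q ≠ r → G.Adj q q' → q' ≠ v → p' ≠ q → p' ≠ r → q' = p' := by
      intro q r q' hq hr hq' vq vr pq pr qr qq' q'v h1 h2
      by_contra h3
      by_cases h4 : q' = p
      · subst h4
        exact hfree.no_path_nbrs hp' hp hq hv hr pp'.symm qq'.symm vq.symm vr h1 p'v h2
          vp.ne.symm pr qr
      · exact hfree.no_path_nbrs hp' hp hv hq hq' pp'.symm vp.symm vq qq' p'v h1 (Ne.symm h3)
          pq (Ne.symm h4) q'v.symm
    have e1 := aux q r q' hq hr hq' vq vr pq pr qr qq' q'v hne.1 hne.2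
    have e2 := aux r q r' hr hq hr' vr vq pr pq qr.symm rr' r'v hne.2 hne.1
    subst e1; subst e2
    exact hfree.no_path_nbrs hp hv hq hp' hr vp.symm vq qq' rr'.symm pq pp'.ne pr q'v.symm
      vr.ne qr
  obtain ⟨p, hp, q, hq, r, hr, pq, pr, qr⟩ := Finset.two_lt_card.1 hk
  simp only [mem_filter] at hp hq hr
  obtain ⟨hp, vp, dp⟩ := hp
  obtain ⟨hq, vq, dq⟩ := hq
  obtain ⟨hr, vr, dr⟩ := hr
  have h2 : ∀ z, G.Adj v z → degIn G (nbrs G u) z ≠ 1 → 1 < degIn G (nbrs G u) z := by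
    intro z vz dz
    have := degIn_pos hv vz.symm
    omega
  obtain ⟨p', hp', pp', p'v⟩ := exists_adj_ne (h2 p vp dp) v
  obtain ⟨q', hq', qq', q'v⟩ := exists_adj_ne (h2 q vq dq) v
  obtain ⟨r', hr', rr', r'v⟩ := exists_adj_ne (h2 r vr dr) v
  have k1 := key p q r p' q' r' hp hq hr hp' hq' hr' vp vq vr pq pr qr pp' p'v qq' q'v rr' r'v
  have k2 := key q p r q' p' r' hq hp hr hq' hp' hr' vq vp vr pq.symm qr pr qq' q'v pp' p'v
    rr' r'v
  have k3 := key r p q r' p' q' hr hp hq hr' hp' hq' vr vp vq pr.symm qr.symm pq rr' r'v pp' p'v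
    qq' q'v
  rcases k1 with rfl | rfl
  · rcases k3 with rfl | rfl
    · exact ⟨r', p', r, hv, hp, hq, hr, vp, vq, vr, pp', rr'.symm, qr⟩
    · exact ⟨r', p, r, hv, hq, hp, hr, vq, vp, vr, pp'.symm, rr'.symm, pr⟩
  · rcases k2 with rfl | rfl
    · exact ⟨q', q, p', hv, hp, hq, hr, vp, vq, vr, qq'.symm, pp', qr⟩
    · exact ⟨q', p, q, hv, hr, hp, hq, vr, vp, vq, pp'.symm, qq'.symm, pq⟩

end Discharging

section Perron

variable {V : Type*} [Fintype V]

/-- A nonnegative eigenvector of an `F₆`-free graph with `m` edges for the eigenvalue `l`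
satisfying `l ^ 2 - l = m - 1`, scaled to have its largest entry, `1`, at `u`. -/
structure IsPerron (G : SimpleGraph V) (m : ℕ) (l : ℝ) (x : V → ℝ) (u : V) : Prop where
  free : F6Free G
  exists_adj : ∀ v, ∃ w, G.Adj v w
  edges : (∑ v, degIn G univ v : ℝ) = 2 * m
  quad : l ^ 2 - l = m - 1
  large : 9.8 < l
  nonneg : ∀ v, 0 ≤ x v
  le_one : ∀ v, x v ≤ 1
  top : x u = 1
  eig : ∀ v, nbrSum G x univ v = l * x v

namespace IsPerron

variable {G : SimpleGraph V} {m : ℕ} {l : ℝ} {x : V → ℝ} {u v w : V}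

theorem sum_nbrs (h : IsPerron G m l x u) : ∑ v ∈ nbrs G u, x v = l := by
  have := h.eig u
  rwa [h.top, mul_one] at this

theorem eig_nbrs (h : IsPerron G m l x u) (hv : v ∈ nbrs G u) :
    1 + nbrSum G x (nbrs G u) v + nbrSum G x (far G u) v = l * x v := by
  rw [← h.eig v, nbrSum_univ G x u v, if_pos (mem_nbrs.1 hv), h.top]

theorem eig_far (h : IsPerron G m l x u) (hw : w ∈ far G u) :
    nbrSum G x (nbrs G u) w + nbrSum G x (far G u) w = l * x w := by
  rw [← h.eig w, nbrSum_univ G x u w, if_neg (mem_far.1 hw).2, zero_add]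

theorem pos (h : IsPerron G m l x u) (hv : v ∈ nbrs G u) : 0 < x v := by
  have h1 := h.eig_nbrs hv
  have h2 := nbrSum_nonneg h.nonneg (G := G) (S := nbrs G u) (v := v)
  have h3 := nbrSum_nonneg h.nonneg (G := G) (S := far G u) (v := v)
  have := h.large
  by_contra! hle
  nlinarith

theorem balance (h : IsPerron G m l x u) :
    ∑ v ∈ nbrs G u, charge G x (nbrs G u) v + 1 =
      ∑ w ∈ far G u, degIn G (nbrs G u) w * (1 - x w) +
        (∑ w ∈ far G u, (degIn G (far G u) w : ℝ)) / 2 := by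
  have h1 : l ^ 2 = #(nbrs G u) + ∑ v ∈ nbrs G u, degIn G (nbrs G u) v * x v +
      ∑ w ∈ far G u, degIn G (nbrs G u) w * x w := by
    rw [← sum_nbrSum, ← sum_nbrSum, sq]
    nth_rw 2 [← h.sum_nbrs]
    rw [Finset.mul_sum, ← Finset.sum_congr rfl fun v hv => h.eig_nbrs hv]
    simp [Finset.sum_add_distrib]
  have h2 := h.edges
  rw [sum_degIn_univ G u] at h2
  have h3 := h.quad
  have h4 := h.sum_nbrs
  rw [sum_charge]
  simp only [sub_mul, one_mul, mul_sub, mul_one, Finset.sum_sub_distrib, ← Finset.sum_div]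
  linarith

theorem neg_one_le_sum_charge (h : IsPerron G m l x u) :
    -1 ≤ ∑ v ∈ nbrs G u, charge G x (nbrs G u) v := by
  have h1 := h.balance
  have h2 : 0 ≤ ∑ w ∈ far G u, degIn G (nbrs G u) w * (1 - x w) :=
    Finset.sum_nonneg fun w _ => mul_nonneg (by positivity) (by linarith [h.le_one w])
  have h3 : (0 : ℝ) ≤ ∑ w ∈ far G u, (degIn G (far G u) w : ℝ) := by positivity
  linarith

theorem sum_far_le (h : IsPerron G m l x u) {Q : Finset V} (hQ : Q ⊆ nbrs G u) (hcard : #Q = 4)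
    (hdeg : ∀ v ∈ Q, 0 < degIn G (nbrs G u) v) : ∑ w ∈ far G u, x w ≤ l - 2 := by
  have h1 : l * ∑ w ∈ far G u, x w ≤ ∑ w ∈ far G u, (degIn G (nbrs G u) w : ℝ) +
      ∑ w ∈ far G u, (degIn G (far G u) w : ℝ) := by
    rw [Finset.mul_sum, ← Finset.sum_add_distrib]
    refine Finset.sum_le_sum fun w hw => ?_
    rw [← h.eig_far hw]
    exact add_le_add (nbrSum_le_degIn h.le_one) (nbrSum_le_degIn h.le_one)
  have h2 := h.edges
  rw [sum_degIn_univ G u] at h2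
  have h3 := h.quad
  have h4 := h.balance
  have h5 : 0 ≤ ∑ w ∈ far G u, degIn G (nbrs G u) w * (1 - x w) :=
    Finset.sum_nonneg fun w _ => mul_nonneg (by positivity) (by linarith [h.le_one w])
  have h6 : l ≤ #(nbrs G u) := by
    rw [← h.sum_nbrs]
    simpa using Finset.sum_le_card_nsmul (nbrs G u) x 1 fun v _ => h.le_one v
  have h7 : ∑ v ∈ nbrs G u, (((degIn G (nbrs G u) v : ℝ) - 1) * x v - degIn G (nbrs G u) v) ≤
      -4 := by
    have ht : ∀ v, 0 < degIn G (nbrs G u) v →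
        ((degIn G (nbrs G u) v : ℝ) - 1) * x v - degIn G (nbrs G u) v ≤ -1 := by
      intro v hv
      have : (1 : ℝ) ≤ degIn G (nbrs G u) v := by exact_mod_cast hv
      nlinarith [h.le_one v]
    calc _ ≤ ∑ v ∈ Q, (((degIn G (nbrs G u) v : ℝ) - 1) * x v - degIn G (nbrs G u) v) := by
          refine Finset.sum_le_sum_of_subset_of_nonpos' hQ fun v _ _ => ?_
          rcases Nat.eq_zero_or_pos (degIn G (nbrs G u) v) with h0 | h0
          · simpa [h0] using h.nonneg v
          · linarith [ht v h0]
      _ ≤ ∑ v ∈ Q, (-1 : ℝ) := Finset.sum_le_sum fun v hv => ht v (hdeg v hv)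
      _ = -4 := by simp [hcard]
  rw [sum_charge] at h4
  have h8 : ∑ v ∈ nbrs G u, (((degIn G (nbrs G u) v : ℝ) - 1) * x v - degIn G (nbrs G u) v) =
      ∑ v ∈ nbrs G u, (((degIn G (nbrs G u) v : ℝ) - 1) * x v - degIn G (nbrs G u) v / 2) -
        (∑ v ∈ nbrs G u, (degIn G (nbrs G u) v : ℝ)) / 2 := by
    rw [Finset.sum_div, ← Finset.sum_sub_distrib]
    exact Finset.sum_congr rfl fun v _ => by ring
  have h9 := h.large
  nlinarith

theorem sum_nbrSum_far_le (h : IsPerron G m l x u) (P : Finset V)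
    (hP : ∀ w ∈ far G u, ∀ p ∈ P, ∀ q ∈ P, G.Adj w p → G.Adj w q → p = q) :
    ∑ p ∈ P, nbrSum G x (far G u) p ≤ ∑ w ∈ far G u, x w := by
  rw [sum_nbrSum]
  refine Finset.sum_le_sum fun w hw => ?_
  have : degIn G P w ≤ 1 := by
    rw [degIn, Finset.card_le_one]
    intro p hp q hq
    rw [mem_filter] at hp hq
    exact hP w hw p hp.1 q hq.1 hp.2 hq.2
  have h1 : (degIn G P w : ℝ) ≤ 1 := by exact_mod_cast this
  nlinarith [h.nonneg w]

end IsPerron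

namespace IsDiamond

variable {G : SimpleGraph V} {m : ℕ} {l : ℝ} {x : V → ℝ} {u a b c e : V}

theorem not_adj_left_left (hfree : F6Free G) (h : IsDiamond G (nbrs G u) a b c e) {w : V}
    (hw : w ∈ far G u) (hwa : G.Adj w a) (hwb : G.Adj w b) : False := by
  have ha := mem_nbrs.1 h.ha; have hb := mem_nbrs.1 h.hb
  have hc := mem_nbrs.1 h.hc; have he := mem_nbrs.1 h.he
  rw [mem_far] at hw
  refine hfree.no_path hwa.symm h.ab h.ac ha.symm h.ae hwb h.bc hc.symm he ?_ hw.1 ?_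
    hb.ne.symm h.be.ne h.ne
  · rintro rfl; exact hw.2 hc
  · rintro rfl; exact hw.2 he

theorem not_adj_left_right (hfree : F6Free G) (h : IsDiamond G (nbrs G u) a b c e) {w : V}
    (hw : w ∈ far G u) (hwa : G.Adj w a) (hwc : G.Adj w c) : False := by
  have ha := mem_nbrs.1 h.ha; have hb := mem_nbrs.1 h.hb
  have hc := mem_nbrs.1 h.hc; have he := mem_nbrs.1 h.he
  rw [mem_far] at hw
  refine hfree.no_path hwa.symm h.ac ha.symm h.ae h.ab hwc hc.symm he h.be.symm hw.1 ?_ ?_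
    h.ne h.bc.ne.symm hb.ne
  · rintro rfl; exact hw.2 he
  · rintro rfl; exact hw.2 hb

theorem eq_of_adj (hfree : F6Free G) (h : IsDiamond G (nbrs G u) a b c e) :
    ∀ w ∈ far G u, ∀ p ∈ ({a, b, c} : Finset V), ∀ q ∈ ({a, b, c} : Finset V),
      G.Adj w p → G.Adj w q → p = q := by
  intro w hw p hp q hq hwp hwq
  simp only [mem_insert, mem_singleton] at hp hq
  rcases hp with rfl | rfl | rfl <;> rcases hq with rfl | rfl | rfl <;>
  first
  | rfl
  | exact (h.not_adj_left_left hfree hw hwp hwq).elim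
  | exact (h.not_adj_left_left hfree hw hwq hwp).elim
  | exact (h.not_adj_left_right hfree hw hwp hwq).elim
  | exact (h.not_adj_left_right hfree hw hwq hwp).elim
  | exact (h.swap.not_adj_left_right hfree hw hwp hwq).elim
  | exact (h.swap.not_adj_left_right hfree hw hwq hwp).elim

theorem mem_of_adj (hfree : F6Free G) (h : IsDiamond G (nbrs G u) a b c e) {v w : V}
    (hv : v ∈ ({a, b, c, e} : Finset V)) (hw : w ∈ nbrs G u) (hvw : G.Adj v w) :
    w ∈ ({a, b, c, e} : Finset V) := by
  simp only [mem_insert, mem_singleton] at hv ⊢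
  rcases hv with rfl | rfl | rfl | rfl
  · have := h.eq_of_adj_left hfree hw hvw; tauto
  · have := h.swap.eq_of_adj_left hfree hw hvw; tauto
  · have := h.eq_of_adj_right hfree hw hvw; tauto
  · have := h.swap'.eq_of_adj_right hfree hw hvw; tauto

theorem sum_charge_lt (hP : IsPerron G m l x u) (h : IsDiamond G (nbrs G u) a b c e) :
    ∑ v ∈ {a, b, c, e}, charge G x (nbrs G u) v < -1 := by
  have hab := h.ab.ne; have hac := h.ac.ne; have hae := h.ae.ne; have hbc := h.bc.ne
  have hbe := h.be.ne; have hce := h.ne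
  have hfree := hP.free
  have hcharge : ∀ v ∈ ({a, b, c, e} : Finset V), charge G x (nbrs G u) v =
      (degIn G (nbrs G u) v : ℝ) / 2 - 1 - ((degIn G (nbrs G u) v : ℝ) - 1) * (1 - x v) := by
    intro v hv
    rw [charge_of_one_lt_degIn (h.one_lt_degIn v hv), coreDeg_eq_degIn]
    intro w hw hvw
    exact (h.one_lt_degIn w (h.mem_of_adj hfree hv hw hvw)).ne'
  have hX := hP.sum_far_le (Q := {a, b, c, e}) (by
    intro v; simp only [mem_insert, mem_singleton]
    rintro (rfl | rfl | rfl | rfl)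
    exacts [h.ha, h.hb, h.hc, h.he]) h.card_eq_four
    fun v hv => Nat.zero_lt_of_lt (h.one_lt_degIn v hv)
  have hl := hP.large
  have Na : ∀ w, w ∈ ({b, c, e} : Finset V) ↔ w ∈ nbrs G u ∧ G.Adj a w := by
    intro w; simp only [mem_insert, mem_singleton]
    refine ⟨?_, fun hw => h.eq_of_adj_left hfree hw.1 hw.2⟩
    rintro (rfl | rfl | rfl)
    exacts [⟨h.hb, h.ab⟩, ⟨h.hc, h.ac⟩, ⟨h.he, h.ae⟩]
  have Nb : ∀ w, w ∈ ({a, c, e} : Finset V) ↔ w ∈ nbrs G u ∧ G.Adj b w := by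
    intro w; simp only [mem_insert, mem_singleton]
    refine ⟨?_, fun hw => h.swap.eq_of_adj_left hfree hw.1 hw.2⟩
    rintro (rfl | rfl | rfl)
    exacts [⟨h.ha, h.ab.symm⟩, ⟨h.hc, h.bc⟩, ⟨h.he, h.be⟩]
  have ea := hP.eig_nbrs h.ha
  have eb := hP.eig_nbrs h.hb
  have ec := hP.eig_nbrs h.hc
  have ee := hP.eig_nbrs h.he
  rw [nbrSum_eq_sum Na] at ea
  rw [nbrSum_eq_sum Nb] at eb
  have da := degIn_eq_card Na
  have db := degIn_eq_card Nb
  have f1 := hP.sum_nbrSum_far_le _ (h.eq_of_adj hfree)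
  have f2 := hP.sum_nbrSum_far_le _ (h.swap'.eq_of_adj hfree)
  have pa := hP.le_one a; have pb := hP.le_one b; have pc := hP.le_one c; have pe := hP.le_one e
  by_cases ce : G.Adj c e
  · have hd : IsDiamond G (nbrs G u) c e a b :=
      ⟨h.hc, h.he, h.ha, h.hb, ce, h.ac.symm, h.bc.symm, h.ae.symm, h.be.symm, hab⟩
    have Nc : ∀ w, w ∈ ({a, b, e} : Finset V) ↔ w ∈ nbrs G u ∧ G.Adj c w := by
      intro w; simp only [mem_insert, mem_singleton]
      refine ⟨?_, fun hw => h.eq_of_adj_right hfree hw.1 hw.2⟩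
      rintro (rfl | rfl | rfl)
      exacts [⟨h.ha, h.ac.symm⟩, ⟨h.hb, h.bc.symm⟩, ⟨h.he, ce⟩]
    have Ne : ∀ w, w ∈ ({a, b, c} : Finset V) ↔ w ∈ nbrs G u ∧ G.Adj e w := by
      intro w; simp only [mem_insert, mem_singleton]
      refine ⟨?_, fun hw => h.swap'.eq_of_adj_right hfree hw.1 hw.2⟩
      rintro (rfl | rfl | rfl)
      exacts [⟨h.ha, h.ae.symm⟩, ⟨h.hb, h.be.symm⟩, ⟨h.hc, ce.symm⟩]
    rw [nbrSum_eq_sum Nc] at ec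
    rw [nbrSum_eq_sum Ne] at ee
    have dc := degIn_eq_card Nc
    have de := degIn_eq_card Ne
    have f3 := hP.sum_nbrSum_far_le {a, b, c, e} (by
      intro w hw p hp q hq hwp hwq
      simp only [mem_insert, mem_singleton] at hp hq
      by_cases hpq : p = c ∧ q = e ∨ p = e ∧ q = c
      · rcases hpq with ⟨rfl, rfl⟩ | ⟨rfl, rfl⟩
        · exact (hd.not_adj_left_left hfree hw hwp hwq).elim
        · exact (hd.not_adj_left_left hfree hw hwq hwp).elim
      · by_cases hpe : p = e ∨ q = e
        · refine h.swap'.eq_of_adj hfree w hw p ?_ q ?_ hwp hwq <;>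
            simp only [mem_insert, mem_singleton] <;> grind
        · refine h.eq_of_adj hfree w hw p ?_ q ?_ hwp hwq <;>
            simp only [mem_insert, mem_singleton] <;> grind)
    rw [Finset.sum_congr rfl hcharge]
    simp [*] at da db dc de ea eb ec ee f3 ⊢
    norm_num
    nlinarith
  · have Nc : ∀ w, w ∈ ({a, b} : Finset V) ↔ w ∈ nbrs G u ∧ G.Adj c w := by
      intro w; simp only [mem_insert, mem_singleton]
      refine ⟨?_, fun hw => ?_⟩
      · rintro (rfl | rfl)
        exacts [⟨h.ha, h.ac.symm⟩, ⟨h.hb, h.bc.symm⟩]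
      · rcases h.eq_of_adj_right hfree hw.1 hw.2 with rfl | rfl | rfl
        exacts [.inl rfl, .inr rfl, (ce hw.2).elim]
    have Ne : ∀ w, w ∈ ({a, b} : Finset V) ↔ w ∈ nbrs G u ∧ G.Adj e w := by
      intro w; simp only [mem_insert, mem_singleton]
      refine ⟨?_, fun hw => ?_⟩
      · rintro (rfl | rfl)
        exacts [⟨h.ha, h.ae.symm⟩, ⟨h.hb, h.be.symm⟩]
      · rcases h.swap'.eq_of_adj_right hfree hw.1 hw.2 with rfl | rfl | rfl
        exacts [.inl rfl, .inr rfl, (ce hw.2.symm).elim]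
    rw [nbrSum_eq_sum Nc] at ec
    rw [nbrSum_eq_sum Ne] at ee
    have dc := degIn_eq_card Nc
    have de := degIn_eq_card Ne
    rw [Finset.sum_congr rfl hcharge]
    simp [*] at da db dc de ea eb ec ee f1 f2 ⊢
    norm_num
    nlinarith

end IsDiamond

end Perron

section Diamonds

variable {V : Type*} [Fintype V] {G : SimpleGraph V} {m : ℕ} {l : ℝ} {x : V → ℝ} {u : V}

theorem IsDiamond.subset_of_mem (hfree : F6Free G) {a b c e a' b' c' e' v : V}
    (h : IsDiamond G (nbrs G u) a b c e) (h' : IsDiamond G (nbrs G u) a' b' c' e')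
    (hv : v ∈ ({a, b, c, e} : Finset V)) (hv' : v ∈ ({a', b', c', e'} : Finset V)) :
    ({a, b, c, e} : Finset V) ⊆ {a', b', c', e'} := by
  have cl := fun {v w : V} => h'.mem_of_adj hfree (v := v) (w := w)
  have ha : a ∈ ({a', b', c', e'} : Finset V) := by
    simp only [mem_insert, mem_singleton] at hv
    rcases hv with rfl | rfl | rfl | rfl
    · exact hv'
    · exact cl hv' h.ha h.ab.symm
    · exact cl hv' h.ha h.ac.symm
    · exact cl hv' h.ha h.ae.symm
  intro w hw
  rw [mem_insert, mem_insert, mem_insert, mem_singleton] at hw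
  rcases hw with rfl | rfl | rfl | rfl
  · exact ha
  · exact cl ha h.hb h.ab
  · exact cl ha h.hc h.ac
  · exact cl ha h.he h.ae

theorem IsPerron.not_isDiamond (hP : IsPerron G m l x u) (a b c e : V) :
    ¬ IsDiamond G (nbrs G u) a b c e := by
  intro h
  set F : Finset (Finset V) :=
    {D | ∃ a b c e, IsDiamond G (nbrs G u) a b c e ∧ D = {a, b, c, e}} with hF
  have memF : ∀ D, D ∈ F ↔ ∃ a b c e, IsDiamond G (nbrs G u) a b c e ∧ D = {a, b, c, e} := by
    simp [hF]
  have hdisj : (F : Set (Finset V)).PairwiseDisjoint id := by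
    intro D hD D' hD' hne
    obtain ⟨a, b, c, e, h, rfl⟩ := (memF D).1 hD
    obtain ⟨a', b', c', e', h', rfl⟩ := (memF D').1 hD'
    refine Finset.disjoint_left.2 fun v hv hv' => hne ?_
    exact (h.subset_of_mem hP.free h' hv hv').antisymm (h'.subset_of_mem hP.free h hv' hv)
  have hsub : F.biUnion id ⊆ nbrs G u := by
    intro v hv
    obtain ⟨D, hD, hv⟩ := Finset.mem_biUnion.1 hv
    obtain ⟨a, b, c, e, h, rfl⟩ := (memF D).1 hD
    simp only [id, mem_insert, mem_singleton] at hv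
    rcases hv with rfl | rfl | rfl | rfl
    exacts [h.ha, h.hb, h.hc, h.he]
  have hlt : ∀ D ∈ F, ∑ v ∈ D, charge G x (nbrs G u) v < -1 := by
    intro D hD
    obtain ⟨a, b, c, e, h, rfl⟩ := (memF D).1 hD
    exact h.sum_charge_lt hP
  have hmem : ({a, b, c, e} : Finset V) ∈ F := (memF _).2 ⟨a, b, c, e, h, rfl⟩
  have h1 : ∑ v ∈ nbrs G u \ F.biUnion id, charge G x (nbrs G u) v ≤ 0 := by
    refine Finset.sum_nonpos fun v hv => charge_nonpos hP.nonneg hP.le_one ?_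
    rw [mem_sdiff] at hv
    by_contra! hk
    obtain ⟨b, c, e, h⟩ := hP.free.exists_isDiamond hv.1 hk
    exact hv.2 (Finset.mem_biUnion.2 ⟨_, (memF _).2 ⟨v, b, c, e, h, rfl⟩, by simp⟩)
  have h2 := hP.neg_one_le_sum_charge
  rw [← Finset.sum_sdiff hsub, Finset.sum_biUnion hdisj, ← Finset.sum_erase_add _ _ hmem] at h2
  have h3 : ∑ D ∈ F.erase {a, b, c, e}, ∑ v ∈ id D, charge G x (nbrs G u) v ≤ 0 :=
    Finset.sum_nonpos fun D hD =>
      (hlt D (Finset.mem_of_mem_erase hD)).le.trans (by norm_num)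
  have h4 := hlt _ hmem
  simp only [id] at h2 h3
  linarith

theorem IsPerron.coreDeg_le_two (hP : IsPerron G m l x u) {v : V} (hv : v ∈ nbrs G u) :
    coreDeg G (nbrs G u) v ≤ 2 := by
  by_contra! hk
  obtain ⟨b, c, e, h⟩ := hP.free.exists_isDiamond hv hk
  exact hP.not_isDiamond _ _ _ _ h

theorem IsPerron.nbrSum_le_sub (hP : IsPerron G m l x u) {v w : V} (hv : v ∈ nbrs G u)
    (hwv : ¬ G.Adj w v) : nbrSum G x (nbrs G u) w ≤ l - x v := by
  rw [← hP.sum_nbrs, ← Finset.sum_erase_eq_sub hv]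
  refine Finset.sum_le_sum_of_subset_of_nonneg (fun z hz => ?_) fun z _ _ => hP.nonneg z
  rw [mem_filter] at hz
  exact mem_erase.2 ⟨by rintro rfl; exact hwv hz.2, hz.1⟩

/-- `nbrs G u` cannot contain a set `Q` of non-leaves, containing a path `q - p - c`, such that
all but one of the neighbours of `p` and of `q` contribute at most `1` in total. -/
theorem IsPerron.false_of_path (hP : IsPerron G m l x u) {Q : Finset V} (hQ : Q ⊆ nbrs G u)
    (hdeg : ∀ v ∈ Q, 1 < degIn G (nbrs G u) v) {p q c : V} (hp : p ∈ Q) (hq : q ∈ Q)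
    (hc : c ∈ Q) (hpq : G.Adj p q) (hpc : G.Adj p c) (hqc : q ≠ c)
    (hsp : nbrSum G x (nbrs G u) p ≤ x q + 1) (hsq : nbrSum G x (nbrs G u) q ≤ x p + 1) :
    False := by
  set N := nbrs G u
  set W := far G u
  have hl := hP.large
  have hpx := hP.le_one p
  have hqx := hP.le_one q
  have hbal := hP.balance
  have hcharge : ∑ v ∈ N, charge G x N v ≤ -∑ v ∈ Q, (1 - x v) := by
    rw [← Finset.sum_neg_distrib]
    refine (Finset.sum_le_sum_of_subset_of_nonpos' hQ fun v hv _ =>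
      charge_nonpos hP.nonneg hP.le_one (hP.coreDeg_le_two hv)).trans
      (Finset.sum_le_sum fun v hv => charge_le_of_one_lt_degIn hP.le_one
        (hP.coreDeg_le_two (hQ hv)) (hdeg v hv))
  have hQle : ∀ v ∈ Q, 1 - x v ≤ ∑ v ∈ Q, (1 - x v) := fun v hv =>
    Finset.single_le_sum (f := fun v => 1 - x v) (fun v _ => by linarith [hP.le_one v]) hv
  have hpq2 : (1 - x p) + (1 - x q) ≤ ∑ v ∈ Q, (1 - x v) := by
    rw [← Finset.sum_pair (f := fun v => 1 - x v) hpq.ne]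
    refine Finset.sum_le_sum_of_subset_of_nonneg ?_ fun v _ _ => by linarith [hP.le_one v]
    intro v; simp only [mem_insert, mem_singleton]; rintro (rfl | rfl) <;> assumption
  have hterm : ∀ w ∈ W, 0 ≤ degIn G N w * (1 - x w) := fun w _ =>
    mul_nonneg (by positivity) (by linarith [hP.le_one w])
  have hA : #{w ∈ W | ∀ v ∈ Q, G.Adj w v} ≤ 1 := by
    rw [Finset.card_le_one]
    intro w hw w' hw'
    rw [mem_filter] at hw hw'
    exact hP.free.eq_of_adj (hQ hp) (hQ hq) (hQ hc) hpq hpc hqc hw.1 hw'.1 (hw.2 p hp)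
      (hw.2 q hq) (hw'.2 p hp) (hw'.2 c hc)
  have hA' : ∑ w ∈ W with ∀ v ∈ Q, G.Adj w v, x w ≤ 1 := by
    have := Finset.sum_le_card_nsmul {w ∈ W | ∀ v ∈ Q, G.Adj w v} x 1 fun w _ => hP.le_one w
    simp only [nsmul_eq_mul, mul_one] at this
    exact this.trans (by exact_mod_cast hA)
  have ep := hP.eig_nbrs (hQ hp)
  have eq := hP.eig_nbrs (hQ hq)
  by_cases hW : ∀ w ∈ W, degIn G W w = 0
  · have hW0 : ∑ w ∈ W, (degIn G W w : ℝ) = 0 :=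
      Finset.sum_eq_zero fun w hw => by simp [hW w hw]
    obtain ⟨y, hy, hmin⟩ := Finset.exists_min_image Q x ⟨p, hp⟩
    have hy0 := hP.pos (hQ hy)
    have h1 : ∀ w ∈ W, (¬ ∀ v ∈ Q, G.Adj w v) → x w * x y ≤ degIn G N w * (1 - x w) := by
      intro w hw hne
      push Not at hne
      obtain ⟨v, hv, hwv⟩ := hne
      have e := hP.eig_far hw
      have e0 : nbrSum G x W w ≤ 0 := by
        simpa [hW w hw] using nbrSum_le_degIn hP.le_one (G := G) (S := W) (v := w)
      have e1 := nbrSum_le_degIn hP.le_one (G := G) (S := N) (v := w)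
      have e2 := hP.nbrSum_le_sub (hQ hv) hwv
      have e3 := nbrSum_nonneg hP.nonneg (G := G) (S := W) (v := w)
      have e4 := hmin v hv
      nlinarith [hP.le_one w, hP.nonneg w]
    have h2 : (∑ w ∈ W with ¬ ∀ v ∈ Q, G.Adj w v, x w) * x y ≤ x y := by
      calc _ ≤ ∑ w ∈ W with ¬ ∀ v ∈ Q, G.Adj w v, degIn G N w * (1 - x w) := by
            rw [Finset.sum_mul]
            refine Finset.sum_le_sum fun w hw => ?_
            rw [mem_filter] at hw
            exact h1 w hw.1 hw.2
        _ ≤ ∑ w ∈ W, degIn G N w * (1 - x w) :=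
            Finset.sum_le_sum_of_subset_of_nonneg (filter_subset _ _) fun w hw _ => hterm w hw
        _ ≤ x y := by linarith [hQle y hy]
    have h3 : ∑ w ∈ W with ¬ ∀ v ∈ Q, G.Adj w v, x w ≤ 1 := by
      by_contra hlt
      nlinarith
    have h4 := Finset.sum_filter_add_sum_filter_not W (fun w => ∀ v ∈ Q, G.Adj w v) x
    have h5 : ∀ v, nbrSum G x W v ≤ ∑ w ∈ W, x w := fun v =>
      Finset.sum_le_sum_of_subset_of_nonneg (filter_subset _ _) fun w _ _ => hP.nonneg w
    have h6 := h5 p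
    have h7 := h5 q
    have h8 : 0 ≤ ∑ w ∈ W, degIn G N w * (1 - x w) := Finset.sum_nonneg hterm
    nlinarith
  · push Not at hW
    obtain ⟨w₁, hw₁, hd⟩ := hW
    obtain ⟨w₂, hw₂, hadj⟩ := exists_adj_of_degIn_pos (Nat.pos_of_ne_zero hd)
    have hge : (2 : ℝ) ≤ ∑ w ∈ W, (degIn G W w : ℝ) := by
      have h1 : (1 : ℝ) ≤ degIn G W w₁ := by exact_mod_cast degIn_pos hw₂ hadj
      have h2 : (1 : ℝ) ≤ degIn G W w₂ := by exact_mod_cast degIn_pos hw₁ hadj.symm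
      have h3 : ∑ w ∈ {w₁, w₂}, (degIn G W w : ℝ) ≤ ∑ w ∈ W, (degIn G W w : ℝ) := by
        refine Finset.sum_le_sum_of_subset_of_nonneg ?_ fun _ _ _ => by positivity
        intro v; simp only [mem_insert, mem_singleton]; rintro (rfl | rfl) <;> assumption
      rw [Finset.sum_pair hadj.ne] at h3
      linarith
    have h8 : 0 ≤ ∑ w ∈ W, degIn G N w * (1 - x w) := Finset.sum_nonneg hterm
    have hsum0 : ∑ w ∈ W, degIn G N w * (1 - x w) = 0 := by linarith
    have hp1 : x p = 1 := by linarith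
    have hterm0 := (Finset.sum_eq_zero_iff_of_nonneg hterm).1 hsum0
    have key : ∀ w ∈ W, G.Adj p w → degIn G W w = 0 → ∀ v ∈ Q, G.Adj w v := by
      intro w hw hpw h0 v hv
      have e0 : nbrSum G x W w ≤ 0 := by
        simpa [h0] using nbrSum_le_degIn hP.le_one (G := G) (S := W) (v := w)
      have e1 : (0 : ℝ) < degIn G N w := by exact_mod_cast degIn_pos (hQ hp) hpw.symm
      have e2 : x w = 1 := by
        rcases mul_eq_zero.1 (hterm0 w hw) with h | h <;> linarith
      have e3 := hP.eig_far hw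
      by_contra hwv
      have e4 := hP.nbrSum_le_sub (hQ hv) hwv
      have e5 := hP.pos (hQ hv)
      rw [e2] at e3
      linarith
    have hbound : nbrSum G x W p ≤ 3 := by
      calc nbrSum G x W p
          ≤ ∑ w ∈ W, ((degIn G W w : ℝ) + if ∀ v ∈ Q, G.Adj w v then x w else 0) := by
            rw [nbrSum, Finset.sum_filter]
            refine Finset.sum_le_sum fun w hw => ?_
            have n0 := hP.nonneg w
            have n1 := hP.le_one w
            rcases Nat.eq_zero_or_pos (degIn G W w) with h0 | h0
            · by_cases hpw : G.Adj p w
              · rw [if_pos hpw, if_pos (key w hw hpw h0)]; simp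
              · rw [if_neg hpw]; split_ifs <;> positivity
            · have : (1 : ℝ) ≤ degIn G W w := by exact_mod_cast h0
              split_ifs <;> linarith
        _ ≤ 3 := by
            rw [Finset.sum_add_distrib, ← Finset.sum_filter]
            linarith [hQle p hp]
    nlinarith

theorem IsPerron.false_of_triangle (hP : IsPerron G m l x u) {p q c : V} (hp : p ∈ nbrs G u)
    (hq : q ∈ nbrs G u) (hc : c ∈ nbrs G u) (hpq : G.Adj p q) (hpc : G.Adj p c)
    (hqc : G.Adj q c) (hp' : ∀ y ∈ nbrs G u, G.Adj p y → y = q ∨ y = c)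
    (hq' : ∀ y ∈ nbrs G u, G.Adj q y → y = p ∨ y = c) : False := by
  refine hP.false_of_path (Q := {p, q, c}) ?_ ?_ (p := p) (q := q) (c := c) (by simp) (by simp)
    (by simp) hpq hpc hqc.ne ?_ ?_
  · intro v; simp only [mem_insert, mem_singleton]; rintro (rfl | rfl | rfl) <;> assumption
  · intro v; simp only [mem_insert, mem_singleton]
    rintro (rfl | rfl | rfl)
    exacts [one_lt_degIn hq hpq hc hpc hqc.ne, one_lt_degIn hp hpq.symm hc hqc hpc.ne,
      one_lt_degIn hp hpc.symm hq hqc.symm hpq.ne]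
  · linarith [nbrSum_le_add hP.nonneg hqc.ne hp', hP.le_one c]
  · linarith [nbrSum_le_add hP.nonneg hpc.ne hq', hP.le_one c]

theorem IsPerron.not_triangle (hP : IsPerron G m l x u) {p q c : V} (hp : p ∈ nbrs G u)
    (hq : q ∈ nbrs G u) (hc : c ∈ nbrs G u) (hpq : G.Adj p q) (hpc : G.Adj p c)
    (hqc : G.Adj q c) : False := by
  have key : ∀ {p q c : V}, p ∈ nbrs G u → q ∈ nbrs G u → c ∈ nbrs G u → G.Adj p q →
      G.Adj p c → G.Adj q c → (∀ y ∈ nbrs G u, G.Adj p y → y = q ∨ y = c) ∨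
        ∀ y ∈ nbrs G u, G.Adj q y → y = p ∨ y = c := by
    intro p q c hp hq hc hpq hpc hqc
    by_contra! hne
    obtain ⟨⟨y, hy, hpy, hyq, hyc⟩, z, hz, hqz, hzp, hzc⟩ := hne
    by_cases hyz : y = z
    · subst hyz
      exact hP.not_isDiamond p q c y ⟨hp, hq, hc, hy, hpq, hpc, hpy, hqc, hqz, hyc.symm⟩
    · exact hP.free.no_path_nbrs hy hp hc hq hz hpy.symm hpc hqc.symm hqz hyc hyq hyz hpq.ne
        hzp.symm hzc.symm
  have h1 := key hp hq hc hpq hpc hqc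
  have h2 := key hp hc hq hpc hpq hqc.symm
  have h3 := key hq hc hp hqc hpq.symm hpc.symm
  have t1 := hP.false_of_triangle hp hq hc hpq hpc hqc
  have t2 := hP.false_of_triangle hp hc hq hpc hpq hqc.symm
  have t3 := hP.false_of_triangle hq hc hp hqc hpq.symm hpc.symm
  simp only [or_comm] at h1 h2 h3 t1 t2 t3
  tauto

theorem IsPerron.not_four_cycle (hP : IsPerron G m l x u) {a b c e : V} (ha : a ∈ nbrs G u)
    (hb : b ∈ nbrs G u) (hc : c ∈ nbrs G u) (he : e ∈ nbrs G u) (hab : G.Adj a b)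
    (hbc : G.Adj b c) (hce : G.Adj c e) (hea : G.Adj e a) (hac : a ≠ c) (hbe : b ≠ e) :
    False := by
  have key : ∀ {a b c e : V}, a ∈ nbrs G u → b ∈ nbrs G u → c ∈ nbrs G u → e ∈ nbrs G u →
      G.Adj a b → G.Adj b c → G.Adj c e → G.Adj e a → a ≠ c → b ≠ e →
      ∀ y ∈ nbrs G u, G.Adj a y → y = b ∨ y = e := by
    intro a b c e ha hb hc he hab hbc hce hea hac hbe y hy hay
    by_contra! hne
    by_cases hyc : y = c
    · subst hyc
      exact hP.not_isDiamond a y b e ⟨ha, hc, hb, he, hay, hab, hea.symm, hbc.symm, hce, hbe⟩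
    · exact hP.free.no_path_nbrs hy ha hb hc he hay.symm hab hbc hce hne.1 hyc hne.2 hac
        hea.ne.symm hbe
  refine hP.false_of_path (Q := {a, b, c, e}) ?_ ?_ (p := a) (q := b) (c := e) (by simp)
    (by simp) (by simp) hab hea.symm hbe ?_ ?_
  · intro v; simp only [mem_insert, mem_singleton]
    rintro (rfl | rfl | rfl | rfl) <;> assumption
  · intro v; simp only [mem_insert, mem_singleton]
    rintro (rfl | rfl | rfl | rfl)
    exacts [one_lt_degIn hb hab he hea.symm hbe, one_lt_degIn ha hab.symm hc hbc hac,
      one_lt_degIn hb hbc.symm he hce hbe, one_lt_degIn ha hea hc hce.symm hac]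
  · linarith [nbrSum_le_add hP.nonneg hbe (key ha hb hc he hab hbc hce hea hac hbe),
      hP.le_one e]
  · linarith [nbrSum_le_add hP.nonneg hac.symm
      (key hb hc he ha hbc hce hea hab hbe hac.symm), hP.le_one c]

end Diamonds

section Structure

variable {V : Type*} [Fintype V] {G : SimpleGraph V} {m : ℕ} {l : ℝ} {x : V → ℝ} {u v w : V}

namespace IsPerron

theorem coreDeg_le_one (hP : IsPerron G m l x u) (hv : v ∈ nbrs G u) :
    coreDeg G (nbrs G u) v ≤ 1 := by
  by_contra! hk
  obtain ⟨p, hp, q, hq, hpq⟩ := Finset.one_lt_card.1 hk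
  simp only [mem_filter] at hp hq
  obtain ⟨hp, vp, dp⟩ := hp
  obtain ⟨hq, vq, dq⟩ := hq
  have h2 : ∀ z, G.Adj v z → degIn G (nbrs G u) z ≠ 1 → 1 < degIn G (nbrs G u) z := by
    intro z vz dz
    have := degIn_pos hv vz.symm
    omega
  obtain ⟨p', hp', pp', p'v⟩ := exists_adj_ne (h2 p vp dp) v
  obtain ⟨q', hq', qq', q'v⟩ := exists_adj_ne (h2 q vq dq) v
  by_cases h1 : p' = q
  · subst h1
    exact hP.not_triangle hv hp hq vp vq pp'
  by_cases h2 : q' = p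
  · subst h2
    exact hP.not_triangle hv hp hq vp vq qq'.symm
  by_cases h3 : p' = q'
  · subst h3
    exact hP.not_four_cycle hv hp hp' hq vp pp' qq'.symm vq.symm p'v.symm hpq
  · exact hP.free.no_path_nbrs hp' hp hv hq hq' pp'.symm vp.symm vq qq' p'v h1 h3 hpq
      (Ne.symm h2) q'v.symm

theorem sum_charge_le (hP : IsPerron G m l x u) {S : Finset V} (hS : S ⊆ nbrs G u) :
    ∑ v ∈ nbrs G u, charge G x (nbrs G u) v ≤ ∑ v ∈ S, charge G x (nbrs G u) v :=
  Finset.sum_le_sum_of_subset_of_nonpos' hS fun _ hv _ =>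
    charge_nonpos hP.nonneg hP.le_one (hP.coreDeg_le_two hv)

theorem neg_one_le_charge_add (hP : IsPerron G m l x u) (hv : v ∈ nbrs G u)
    (hw : w ∈ nbrs G u) (hne : v ≠ w) :
    -1 ≤ charge G x (nbrs G u) v + charge G x (nbrs G u) w := by
  rw [← Finset.sum_pair hne]
  refine hP.neg_one_le_sum_charge.trans (hP.sum_charge_le ?_)
  intro z; simp only [mem_insert, mem_singleton]; rintro (rfl | rfl) <;> assumption

theorem charge_le (hP : IsPerron G m l x u) (hv : v ∈ nbrs G u)
    (hd : 1 < degIn G (nbrs G u) v) :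
    charge G x (nbrs G u) v ≤ -(1 / 2) - (1 - x v) := by
  have h1 : (coreDeg G (nbrs G u) v : ℝ) ≤ 1 := by exact_mod_cast hP.coreDeg_le_one hv
  have h2 : (2 : ℝ) ≤ degIn G (nbrs G u) v := by exact_mod_cast hd
  rw [charge_of_one_lt_degIn hd]
  nlinarith [hP.le_one v]

theorem far_of_sum_charge_le (hP : IsPerron G m l x u)
    (hsum : ∑ v ∈ nbrs G u, charge G x (nbrs G u) v ≤ -1) (hw : w ∈ far G u) :
    x w = 1 ∧ ∀ v ∈ nbrs G u, G.Adj w v := by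
  have hbal := hP.balance
  have hterm : ∀ w ∈ far G u, 0 ≤ degIn G (nbrs G u) w * (1 - x w) := fun w _ =>
    mul_nonneg (by positivity) (by linarith [hP.le_one w])
  have hterm' : ∀ w ∈ far G u, (0 : ℝ) ≤ degIn G (far G u) w := fun w _ => by positivity
  have hs := Finset.sum_nonneg hterm
  have hs' := Finset.sum_nonneg hterm'
  have h1 := (Finset.sum_eq_zero_iff_of_nonneg hterm).1 (by linarith) w hw
  have h2 : degIn G (far G u) w = 0 := by
    exact_mod_cast (Finset.sum_eq_zero_iff_of_nonneg hterm').1 (by linarith) w hw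
  obtain ⟨z, hwz⟩ := hP.exists_adj w
  have hz : z ∈ nbrs G u := by
    rw [mem_nbrs]
    by_contra hz
    rcases eq_or_ne z u with rfl | hzu
    · exact (mem_far.1 hw).2 hwz.symm
    · exact (degIn_pos (mem_far.2 ⟨hzu, hz⟩) hwz).ne' h2
  have h3 : (0 : ℝ) < degIn G (nbrs G u) w := by exact_mod_cast degIn_pos hz hwz
  have h4 : x w = 1 := by
    rcases mul_eq_zero.1 h1 with h | h <;> linarith
  refine ⟨h4, fun v hv => ?_⟩
  by_contra hwv
  have h5 := hP.eig_far hw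
  have h6 : nbrSum G x (far G u) w ≤ 0 := by
    simpa [h2] using nbrSum_le_degIn hP.le_one (G := G) (S := far G u) (v := w)
  have h7 := hP.nbrSum_le_sub hv hwv
  have h8 := hP.pos hv
  rw [h4] at h5
  linarith

/-- Two adjacent non-leaves of `nbrs G u` cannot exist. -/
theorem not_adj_of_one_lt_degIn (hP : IsPerron G m l x u) (hv : v ∈ nbrs G u)
    (hw : w ∈ nbrs G u) (hdv : 1 < degIn G (nbrs G u) v) (hdw : 1 < degIn G (nbrs G u) w) :
    ¬ G.Adj v w := by
  intro hvw
  have hcv := hP.charge_le hv hdv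
  have hcw := hP.charge_le hw hdw
  have hge := hP.neg_one_le_charge_add hv hw hvw.ne
  have hv1 := hP.le_one v
  have hw1 := hP.le_one w
  have hsum : ∑ v ∈ nbrs G u, charge G x (nbrs G u) v ≤ -1 := by
    refine (hP.sum_charge_le (S := {v, w}) ?_).trans ?_
    · intro z; simp only [mem_insert, mem_singleton]; rintro (rfl | rfl) <;> assumption
    · rw [Finset.sum_pair hvw.ne]; linarith
  obtain ⟨q, hq, hvq, hqw⟩ := exists_adj_ne hdv w
  have hcard : #(far G u) ≤ 1 := Finset.card_le_one.2 fun y hy z hz =>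
    hP.free.eq_of_adj hv hw hq hvw hvq hqw.symm hy hz ((hP.far_of_sum_charge_le hsum hy).2 v hv)
      ((hP.far_of_sum_charge_le hsum hy).2 w hw) ((hP.far_of_sum_charge_le hsum hz).2 v hv)
      ((hP.far_of_sum_charge_le hsum hz).2 q hq)
  have hfar : ∀ z, nbrSum G x (far G u) z ≤ 1 := fun z =>
    (nbrSum_le_degIn hP.le_one).trans
      (by exact_mod_cast (Finset.card_filter_le _ _).trans hcard)
  have hdisj : nbrSum G x (nbrs G u) v + nbrSum G x (nbrs G u) w ≤ l := by
    rw [← hP.sum_nbrs, nbrSum, nbrSum, ← Finset.sum_union]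
    · exact Finset.sum_le_sum_of_subset_of_nonneg
        (Finset.union_subset (filter_subset _ _) (filter_subset _ _)) fun z _ _ => hP.nonneg z
    · refine Finset.disjoint_left.2 fun z hz hz' => ?_
      rw [mem_filter] at hz hz'
      exact hP.not_triangle hv hw hz.1 hvw hz.2 hz'.2
  have ev := hP.eig_nbrs hv
  have ew := hP.eig_nbrs hw
  have hxv : x v = 1 := by linarith
  have hxw : x w = 1 := by linarith
  rw [hxv] at ev
  rw [hxw] at ew
  linarith [hP.large, hfar v, hfar w]

theorem exists_one_lt_degIn (hP : IsPerron G m l x u) :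
    ∃ v ∈ nbrs G u, 1 < degIn G (nbrs G u) v := by
  by_contra! hd
  have h1 : ∑ v ∈ nbrs G u, charge G x (nbrs G u) v ≤ ∑ v ∈ nbrs G u, -(1 / 2) * x v := by
    refine Finset.sum_le_sum fun v hv => ?_
    rcases Nat.eq_zero_or_pos (degIn G (nbrs G u) v) with h0 | h0
    · rw [charge_of_degIn_eq_zero h0]
      linarith [hP.nonneg v]
    · obtain ⟨w, hw, hvw⟩ := exists_adj_of_degIn_pos h0
      rw [charge_of_degIn_eq_one (le_antisymm (hd v hv) h0) hw hvw,
        if_pos (le_antisymm (hd w hw) (degIn_pos hv hvw.symm))]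
      linarith [hP.le_one v]
  rw [← Finset.mul_sum, hP.sum_nbrs] at h1
  linarith [hP.neg_one_le_sum_charge, hP.large]

/-- `G` is the join of an edge `uv` with an empty graph. -/
theorem exists_adj_iff (hP : IsPerron G m l x u) :
    ∃ v, G.Adj u v ∧ ∀ w, w ≠ u → w ≠ v → ∀ z, G.Adj w z ↔ z = u ∨ z = v := by
  obtain ⟨v, hv, hdv⟩ := hP.exists_one_lt_degIn
  have hcore : coreDeg G (nbrs G u) v = 0 := by
    rw [coreDeg, Finset.card_eq_zero, Finset.filter_eq_empty_iff]
    rintro w hw ⟨hvw, hdw⟩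
    have := degIn_pos hv hvw.symm
    exact hP.not_adj_of_one_lt_degIn hv hw hdv (by omega) hvw
  have hcv : charge G x (nbrs G u) v ≤ -1 := by
    have h2 : (2 : ℝ) ≤ degIn G (nbrs G u) v := by exact_mod_cast hdv
    rw [charge_of_one_lt_degIn hdv, hcore]
    push_cast
    nlinarith [hP.le_one v]
  have hxv : x v = 1 := by
    have := hP.neg_one_le_sum_charge.trans (hP.sum_charge_le (singleton_subset_iff.2 hv))
    rw [Finset.sum_singleton, charge_of_one_lt_degIn hdv, hcore] at this
    have h2 : (2 : ℝ) ≤ degIn G (nbrs G u) v := by exact_mod_cast hdv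
    push_cast at this
    nlinarith [hP.le_one v]
  have hleaf : ∀ w ∈ nbrs G u, w ≠ v → G.Adj w v ∧ degIn G (nbrs G u) w = 1 := by
    have hle : ∀ w ∈ nbrs G u, w ≠ v → degIn G (nbrs G u) w ≤ 1 := by
      intro w hw hne
      by_contra! hdw
      linarith [hP.neg_one_le_charge_add hv hw hne.symm, hP.charge_le hw hdw, hP.le_one w]
    intro w hw hne
    have hcw := hP.neg_one_le_charge_add hv hw hne.symm
    have hd := hle w hw hne
    rcases Nat.eq_zero_or_pos (degIn G (nbrs G u) w) with h0 | h0
    · rw [charge_of_degIn_eq_zero h0] at hcw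
      linarith [hP.pos hw]
    · obtain ⟨y, hy, hwy⟩ := exists_adj_of_degIn_pos h0
      rcases eq_or_ne y v with rfl | hyv
      · exact ⟨hwy, by omega⟩
      · have hdy := hle y hy hyv
        have := degIn_pos hw hwy.symm
        rw [charge_of_degIn_eq_one (by omega) hy hwy, if_pos (by omega)] at hcw
        linarith
  have hfar : ∀ w, w ∉ far G u := by
    intro w hw
    have hall := hP.far_of_sum_charge_le ((hP.sum_charge_le (singleton_subset_iff.2 hv)).trans
      (by rwa [Finset.sum_singleton])) hw
    have h1 := hP.eig_nbrs hv
    have h2 : nbrSum G x (nbrs G u) v = l - x v := by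
      rw [← hP.sum_nbrs, ← Finset.sum_erase_eq_sub hv]
      refine nbrSum_eq_sum fun y => ?_
      rw [mem_erase, and_comm]
      exact and_congr_right fun hy => ⟨fun hyv => (hleaf y hy hyv).1.symm, fun h => h.ne.symm⟩
    have h3 := le_nbrSum hP.nonneg hw (hall.2 v hv).symm
    rw [h2, hxv] at h1
    linarith [hall.1]
  have hmem : ∀ w, w ≠ u → w ∈ nbrs G u := by
    intro w hw
    have := hfar w
    rw [mem_far] at this
    rw [mem_nbrs]
    tauto
  refine ⟨v, mem_nbrs.1 hv, fun w hwu hwv z => ?_⟩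
  have hw := hmem w hwu
  obtain ⟨hadj, hd⟩ := hleaf w hw hwv
  refine ⟨fun hwz => or_iff_not_imp_left.2 fun hzu =>
    eq_of_degIn_eq_one hd (hmem z hzu) hwz hv hadj, ?_⟩
  rintro (rfl | rfl)
  exacts [(mem_nbrs.1 hw).symm, hadj]

end IsPerron

end Structure

section Characterization

variable {V : Type*} {G : SimpleGraph V} {u v : V}

theorem adj_of_adj_iff (huv : G.Adj u v)
    (hadj : ∀ w, w ≠ u → w ≠ v → ∀ z, G.Adj w z ↔ z = u ∨ z = v) {w : V} (hw : w ≠ u) :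
    G.Adj u w := by
  rcases eq_or_ne w v with rfl | hwv
  · exact huv
  · exact ((hadj w hw hwv u).2 (.inl rfl)).symm

variable [Fintype V]

theorem sum_degIn_univ_eq (G : SimpleGraph V) :
    ∑ v, degIn G univ v = 2 * G.edgeSet.ncard := by
  rw [Set.ncard_eq_toFinset_card', ← SimpleGraph.edgeFinset, ← G.sum_degrees_eq_twice_card_edges]
  exact Finset.sum_congr rfl fun v _ => by
    rw [← G.card_neighborFinset_eq_degree v]; exact degIn_eq_card (by simp)

theorem ncard_edgeSet_of_adj_iff (huv : G.Adj u v)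
    (hadj : ∀ w, w ≠ u → w ≠ v → ∀ z, G.Adj w z ↔ z = u ∨ z = v) :
    G.edgeSet.ncard = 2 * #((univ.erase u).erase v) + 1 := by
  have hv : v ∈ univ.erase u := mem_erase.2 ⟨huv.ne.symm, mem_univ v⟩
  have h1 := sum_degIn_univ_eq G
  have hdeg : ∀ {u v : V}, G.Adj u v →
      (∀ w, w ≠ u → w ≠ v → ∀ z, G.Adj w z ↔ z = u ∨ z = v) →
      degIn G univ u = #((univ.erase u).erase v) + 1 := by
    intro u v huv hadj
    rw [Finset.card_erase_add_one (mem_erase.2 ⟨huv.ne.symm, mem_univ v⟩)]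
    refine degIn_eq_card fun w => ?_
    simp only [mem_erase, mem_univ, and_true, true_and]
    exact ⟨adj_of_adj_iff huv hadj, fun h => h.ne.symm⟩
  have h2 : ∀ w ∈ (univ.erase u).erase v, degIn G univ w = 2 := by
    intro w hw
    simp only [mem_erase, mem_univ, and_true] at hw
    rw [← Finset.card_pair huv.ne]
    exact degIn_eq_card fun z => by simp [hadj w hw.2 hw.1 z]
  rw [← Finset.add_sum_erase _ _ (mem_univ u), ← Finset.add_sum_erase _ _ hv,
    Finset.sum_congr rfl h2, hdeg huv hadj, hdeg huv.symm
      fun w h h' z => (hadj w h' h z).trans or_comm, Finset.erase_right_comm (a := v),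
    Finset.sum_const, smul_eq_mul] at h1
  omega

theorem nonempty_iso_of_adj_iff (huv : G.Adj u v)
    (hadj : ∀ w, w ≠ u → w ≠ v → ∀ z, G.Adj w z ↔ z = u ∨ z = v) :
    Nonempty (G ≃g K2JoinEmpty #((univ.erase u).erase v)) := by
  set T := (univ.erase u).erase v
  have hT : ∀ i : Fin #T, (T.equivFin.symm i : V) ≠ u ∧ (T.equivFin.symm i : V) ≠ v := by
    intro i
    have := (T.equivFin.symm i).2
    simp only [T, mem_erase, mem_univ, and_true] at this
    exact this.symm
  set f : Fin 2 ⊕ Fin #T → V := Sum.elim ![u, v] fun i => T.equivFin.symm i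
  have hf : Function.Bijective f := by
    refine ⟨?_, fun w => ?_⟩
    · rintro (a | a) (b | b) h
      · fin_cases a <;> fin_cases b <;> simp_all [f, huv.ne, huv.ne.symm]
      · have := hT b
        fin_cases a <;> simp_all [f]
      · have := hT a
        fin_cases b <;> simp_all [f]
      · simp only [f, Sum.elim_inr] at h
        rw [T.equivFin.symm.injective (Subtype.ext h)]
    · rcases eq_or_ne w u with rfl | hwu
      · exact ⟨.inl 0, rfl⟩
      rcases eq_or_ne w v with rfl | hwv
      · exact ⟨.inl 1, rfl⟩
      · exact ⟨.inr (T.equivFin ⟨w, by simp [T, hwu, hwv]⟩), by simp [f]⟩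
  refine ⟨(⟨Equiv.ofBijective f hf, ?_⟩ : K2JoinEmpty #T ≃g G).symm⟩
  rintro (a | a) (b | b)
  · fin_cases a <;> fin_cases b <;> simp [f, K2JoinEmpty, huv, huv.symm]
  · have := hadj _ (hT b).1 (hT b).2
    fin_cases a <;> simp [f, K2JoinEmpty, G.adj_comm _ (T.equivFin.symm b : V), this]
  · have := hadj _ (hT a).1 (hT a).2
    fin_cases b <;> simp [f, K2JoinEmpty, this]
  · have := hadj _ (hT a).1 (hT a).2
    simp [f, K2JoinEmpty, this, hT b]

end Characterization

theorem stmt_3 {V : Type} [Fintype V] (G : SimpleGraph V) (m : ℕ) (hm : 88 ≤ m)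
    (hfree : F6Free G) (hcard : G.edgeSet.ncard = m)
    (hnoiso : ∀ v : V, ∃ w, G.Adj v w) :
    specRad G = (1 + Real.sqrt (4 * (m : ℝ) - 3)) / 2 ↔
      Odd m ∧ Nonempty (G ≃g K2JoinEmpty ((m - 1) / 2)) := by
  have hm' : (88 : ℝ) ≤ m := by exact_mod_cast hm
  constructor
  · intro hl
    have hne : Nonempty V := by
      by_contra hV
      rw [not_nonempty_iff] at hV
      have : G.edgeSet = ∅ := Set.eq_empty_of_isEmpty _
      rw [this, Set.ncard_empty] at hcard
      omega
    obtain ⟨x, u, h0, h1, hu, heig⟩ := exists_perron_vector G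
    have hs := Real.sq_sqrt (show (0 : ℝ) ≤ 4 * (m : ℝ) - 3 by linarith)
    have hs' : (18.6 : ℝ) < √(4 * (m : ℝ) - 3) := Real.lt_sqrt_of_sq_lt (by linarith)
    have hP : IsPerron G m (specRad G) x u :=
      { free := hfree
        exists_adj := hnoiso
        edges := by exact_mod_cast hcard ▸ sum_degIn_univ_eq G
        quad := by rw [hl]; linarith
        large := by rw [hl]; linarith
        nonneg := h0
        le_one := h1
        top := hu
        eig := heig }
    obtain ⟨v, huv, hadj⟩ := hP.exists_adj_iff
    have hm2 := ncard_edgeSet_of_adj_iff huv hadj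
    rw [hcard] at hm2
    rw [hm2]
    refine ⟨odd_two_mul_add_one _, ?_⟩
    rw [Nat.add_sub_cancel, Nat.mul_div_cancel_left _ two_pos]
    exact nonempty_iso_of_adj_iff huv hadj
  · rintro ⟨⟨k, rfl⟩, ⟨f⟩⟩
    rw [show (2 * k + 1 - 1) / 2 = k by omega] at f
    rw [specRad_congr f, specRad_K2JoinEmpty (by omega)]
    push_cast
    ring_nf
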